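/- arXiv:1506.01625 — 2 statements merged into one kernel-verified Lean document; each statement's English description precedes it below -/
import Mathlib

section
/- Let φ be a nondegenerate Bernstein function with extension φ(z) to Re z ≥ 0, and let a > 0 and b > 0. Then the infinite product L(a,b) = ∏_{k=1}^∞ φ(a + k)/|φ(a + k + i b)| converges in (0,∞), and e^{−19/(8a)} ≤ √( φ(a)/|φ(a + i b)| ) · e^{b·Θ_φ(a,b)} · L(a,b) ≤ e^{19/(8a)}, where Θ_φ(a,b) = ∫_{a/b}^∞ log( |φ(b u + i b)| / φ(b u) ) du. (Paper: Proposition 'prop:asymt_bound_Olver1', the two-sided estimate (eqn:estimateComplexLine) with l = 0 combined with the bound e^{−19/(8a)} ≤ E_φ(a,|b|) ≤ e^{19/(8a)}.) -/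
open MeasureTheory

/-- The quantity `Θ_φ(a,b) = ∫_{a/b}^∞ log(|φ(bu + ib)|/φ(bu)) du`. -/
noncomputable def Theta (φC : ℂ → ℂ) (a b : ℝ) : ℝ :=
  ∫ u in Set.Ioi (a / b),
    Real.log (‖φC (((b * u : ℝ) : ℂ) + (b : ℂ) * Complex.I)‖ / (φC ((b * u : ℝ) : ℂ)).re)


lemma bern_trap (h : ℝ → ℝ) (hc : ContinuousOn h (Set.Ioi 0))
    (hconv : ConvexOn ℝ (Set.Ioi 0) (fun x => h x - 6 * Real.log x)) (c : ℝ) (c0 : 0 < c) :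
    (∫ x in c..(c+1), h x) - (h c + h (c+1)) / 2 ≤ 3/2 * (1/c - 1/(c+1)) := by
  have hsub : Set.uIcc c (c+1) ⊆ Set.Ioi 0 := by
    intro x hx
    rw [Set.uIcc_of_le (by linarith)] at hx
    exact lt_of_lt_of_le c0 hx.1
  have hih : IntervalIntegrable h volume c (c+1) := (hc.mono hsub).intervalIntegrable
  have hlog : IntervalIntegrable (fun x => 6 * Real.log x) volume c (c+1) := 
    intervalIntegral.intervalIntegrable_log'.const_mul 6
  set g : ℝ → ℝ := fun x => h x - 6 * Real.log x with hg
  have hig : IntervalIntegrable g volume c (c+1) := hih.sub hlog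
  have key : (∫ x in c..(c+1), g x) ≤ ∫ x in c..(c+1), (g c + (x - c) * (g (c+1) - g c)) := by
    apply intervalIntegral.integral_mono_on (by linarith) hig
    · apply Continuous.intervalIntegrable; fun_prop
    · intro x hx
      have := hconv.2 (show c ∈ Set.Ioi 0 from c0) (show c+1 ∈ Set.Ioi 0 by simp; linarith)
        (show 0 ≤ 1 - (x-c) by linarith [hx.2]) (show 0 ≤ x - c by linarith [hx.1]) (by ring)
      simp only [smul_eq_mul] at this
      have e : (1 - (x-c)) * c + (x-c)*(c+1) = x := by ring
      rw [e] at this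
      change g x ≤ (1-(x-c)) * g c + (x-c) * g (c+1) at this
      linarith
  have e1 : (∫ x in c..(c+1), (g c + (x - c) * (g (c+1) - g c))) = (g c + g (c+1))/2 := by
    rw [intervalIntegral.integral_add (by simp) (by apply Continuous.intervalIntegrable; fun_prop),
      intervalIntegral.integral_mul_const, intervalIntegral.integral_sub (by simp) (by simp)]
    simp
    ring
  have e2 : (∫ x in c..(c+1), g x) = (∫ x in c..(c+1), h x) - 6 * ((c+1)*Real.log (c+1) - c * Real.log c - 1) := by
    rw [hg, intervalIntegral.integral_sub hih hlog, intervalIntegral.integral_const_mul, integral_log]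
    ring
  have e3 : Real.log (c+1) - Real.log c ≤ (2*c+1)/(2*c*(c+1)) := by
    rw [← Real.log_div (by linarith) (by linarith)]
    have hx : 1 ≤ (c+1)/c := by rw [le_div_iff₀ c0]; linarith
    set x := (c+1)/c with hxd
    have : Real.log x ≤ (x - x⁻¹)/2 := by
      have := Real.self_le_sinh_iff.2 (Real.log_nonneg hx)
      rwa [Real.sinh_log (by linarith)] at this
    refine this.trans (le_of_eq ?_)
    rw [hxd]; field_simp; ring
  have e4 : (c+1/2) * (Real.log (c+1) - Real.log c) - 1 ≤ 1/4 * (1/c - 1/(c+1)) := by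
    have := mul_le_mul_of_nonneg_left e3 (show 0 ≤ c+1/2 by linarith)
    have e : (c+1/2) * ((2*c+1)/(2*c*(c+1))) = 1 + 1/4 * (1/c - 1/(c+1)) := by
      field_simp; ring
    linarith
  rw [e1, e2] at key
  simp only [hg] at key
  linarith

lemma bern_sum (h : ℝ → ℝ) (hc : ContinuousOn h (Set.Ioi 0))
    (hconv : ConvexOn ℝ (Set.Ioi 0) (fun x => h x - 6 * Real.log x)) (a : ℝ) (a0 : 0 < a) (n : ℕ) :
    (∫ x in a..(a+n), h x) - h a / 2 - (∑ k ∈ Finset.range n, h (a+k+1)) + h (a+n) / 2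
      ≤ 3/2 * (1/a - 1/(a+n)) := by
  induction n with
  | zero => simp
  | succ n ih =>
    have t := bern_trap h hc hconv (a+n) (by positivity)
    have ii : ∀ u v : ℝ, 0 < u → 0 < v → IntervalIntegrable h volume u v := by
      intro u v hu hv
      refine (hc.mono ?_).intervalIntegrable
      intro x hx
      exact lt_of_lt_of_le (lt_min hu hv) hx.1
    have := intervalIntegral.integral_add_adjacent_intervals (ii a (a+n) a0 (by positivity))
      (ii (a+n) (a+n+1) (by positivity) (by positivity))
    rw [Finset.sum_range_succ]
    push_cast
    rw [← add_assoc, ← this]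
    linarith

lemma bern_core (h : ℝ → ℝ) (hc : ContinuousOn h (Set.Ioi 0))
    (hconv : ConvexOn ℝ (Set.Ioi 0) (fun x => h x - 6 * Real.log x))
    (hconv' : ConvexOn ℝ (Set.Ioi 0) (fun x => -h x - 6 * Real.log x)) (a : ℝ) (a0 : 0 < a)
    (h0 : ∀ x, 0 < x → 0 ≤ h x) (C : ℝ) (hC : ∀ x, a ≤ x → h x ≤ C / x ^ 2) :
    ∃ S : ℝ, Filter.Tendsto (fun n : ℕ => ∑ k ∈ Finset.range n, h (a+k+1)) Filter.atTop (nhds S)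
      ∧ |(∫ x in Set.Ioi a, h x) - h a / 2 - S| ≤ 19 / (8*a) := by
  have hint : IntegrableOn h (Set.Ioi a) := by
    have i1 : IntegrableOn (fun x : ℝ => C * x ^ (-2:ℝ)) (Set.Ioi a) :=
      (integrableOn_Ioi_rpow_of_lt (by norm_num) a0).const_mul C
    refine Integrable.mono' i1 ((hc.mono (Set.Ioi_subset_Ioi a0.le)).aestronglyMeasurable
      measurableSet_Ioi) ?_
    refine (ae_restrict_iff' measurableSet_Ioi).2 (Filter.Eventually.of_forall fun x hx => ?_)
    have hx' : a < x := hx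
    rw [Real.norm_of_nonneg (h0 x (a0.trans hx')), Real.rpow_neg (by linarith)]
    have := hC x hx'.le
    rw [div_eq_mul_inv] at this
    exact_mod_cast this
  have tn : Filter.Tendsto (fun n : ℕ => a + (n:ℝ)) Filter.atTop Filter.atTop :=
    Filter.tendsto_atTop_add_const_left _ _ tendsto_natCast_atTop_atTop
  have tI : Filter.Tendsto (fun n : ℕ => ∫ x in a..(a+n), h x) Filter.atTop
      (nhds (∫ x in Set.Ioi a, h x)) := intervalIntegral_tendsto_integral_Ioi a hint tn
  have tinv : Filter.Tendsto (fun n : ℕ => 1 / (a + (n:ℝ))) Filter.atTop (nhds 0) := by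
    simp only [one_div]
    exact tn.inv_tendsto_atTop
  have th : Filter.Tendsto (fun n : ℕ => h (a+n)) Filter.atTop (nhds 0) := by
    refine squeeze_zero (fun n => h0 _ (by positivity)) (fun n => hC _ (by simp)) ?_
    have := ((tinv.pow 2).const_mul C)
    simpa [div_eq_mul_inv] using this
  have up := bern_sum h hc hconv a a0
  have lo := bern_sum (fun x => - h x) hc.neg hconv' a a0
  simp only [intervalIntegral.integral_neg, Finset.sum_neg_distrib] at lo
  have mono : Monotone (fun n : ℕ => ∑ k ∈ Finset.range n, h (a+k+1)) := by
    refine monotone_nat_of_le_succ fun n => ?_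
    rw [Finset.sum_range_succ]
    have := h0 (a+n+1) (by positivity)
    linarith
  have bdd : BddAbove (Set.range (fun n : ℕ => ∑ k ∈ Finset.range n, h (a+k+1))) := by
    have tt : Filter.Tendsto (fun n : ℕ => (∫ x in a..(a+n), h x) - h a / 2 + h (a+n) / 2
        + 3/2 * (1/a - 1/(a+n))) Filter.atTop
        (nhds ((∫ x in Set.Ioi a, h x) - h a / 2 + 0/2 + 3/2 * (1/a - 0))) :=
      ((tI.sub_const _).add (th.div_const 2)).add ((tinv.const_sub (1/a)).const_mul (3/2))
    obtain ⟨B, hB⟩ := tt.bddAbove_range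
    refine ⟨B, ?_⟩
    rintro _ ⟨n, rfl⟩
    have := hB ⟨n, rfl⟩
    have l := lo n
    simp only at this ⊢
    linarith
  obtain ⟨S, tS⟩ : ∃ S, Filter.Tendsto (fun n : ℕ => ∑ k ∈ Finset.range n, h (a+k+1)) Filter.atTop (nhds S) :=
    ⟨_, tendsto_atTop_ciSup mono bdd⟩
  refine ⟨S, tS, ?_⟩
  have tt : Filter.Tendsto (fun n : ℕ => (∫ x in a..(a+n), h x) - h a / 2 -
      (∑ k ∈ Finset.range n, h (a+k+1)) + h (a+n) / 2) Filter.atTop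
      (nhds ((∫ x in Set.Ioi a, h x) - h a / 2 - S + 0/2)) :=
    ((tI.sub_const _).sub tS).add (th.div_const 2)
  have pinv : ∀ n : ℕ, 0 ≤ 1/(a+(n:ℝ)) := fun n => by positivity
  have e : 19/(8*a) = 19/8 * (1/a) := by field_simp
  have ap : 0 < 1/a := by positivity
  rw [abs_le, e]
  constructor
  · have := ge_of_tendsto' (b := -(3/2 * (1/a))) tt (fun n => by have := lo n; have := pinv n; linarith)
    linarith
  · have := le_of_tendsto' (b := (3/2 * (1/a))) tt (fun n => by have := up n; have := pinv n; linarith)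
    linarith

lemma bern_p1 (x y : ℝ) (hx : 0 < x) : y * Real.exp (-(x*y)) ≤ 1/x * (1 - Real.exp (-(x*y))) := by
  have h1 := Real.add_one_le_exp (x*y)
  have h2 : Real.exp (x*y) * Real.exp (-(x*y)) = 1 := by rw [← Real.exp_add]; simp
  have h3 := Real.exp_pos (-(x*y))
  rw [div_mul_eq_mul_div, le_div_iff₀ hx]
  nlinarith

lemma bern_p2 (x y : ℝ) (hx : 0 < x) (hy : 0 < y) :
    y^2 * Real.exp (-(x*y)) ≤ 2/x^2 * (1 - Real.exp (-(x*y))) := by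
  have h1 := Real.quadratic_le_exp_of_nonneg (show 0 ≤ x*y by positivity)
  have h2 : Real.exp (x*y) * Real.exp (-(x*y)) = 1 := by rw [← Real.exp_add]; simp
  have h3 := Real.exp_pos (-(x*y))
  have hxy : 0 < x*y := by positivity
  rw [div_mul_eq_mul_div, le_div_iff₀ (by positivity)]
  nlinarith

lemma bern_normexp (z : ℂ) (y : ℝ) : ‖Complex.exp (-(z * (y:ℂ)))‖ = Real.exp (-(z.re*y)) := by
  rw [Complex.norm_exp]; simp

lemma bern_re (z : ℂ) (y : ℝ) : (1 - Complex.exp (-(z * (y:ℂ)))).re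
    = 1 - Real.exp (-(z.re*y)) * Real.cos (z.im * y) := by
  simp [Complex.exp_re]

lemma bern_im (z : ℂ) (y : ℝ) : (1 - Complex.exp (-(z * (y:ℂ)))).im
    = Real.exp (-(z.re*y)) * Real.sin (z.im * y) := by
  simp [Complex.exp_im]

lemma bern_re_lo (z : ℂ) (y : ℝ) : 1 - Real.exp (-(z.re*y)) ≤ (1 - Complex.exp (-(z * (y:ℂ)))).re := by
  rw [bern_re]
  have h3 := Real.exp_pos (-(z.re*y))
  nlinarith [Real.cos_le_one (z.im*y)]

lemma bern_re_hi (z : ℂ) (y : ℝ) (hx : 0 < z.re) (hy : 0 < y) : (1 - Complex.exp (-(z * (y:ℂ)))).re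
    ≤ (1 + z.im^2/z.re^2) * (1 - Real.exp (-(z.re*y))) := by
  rw [bern_re]
  have h3 := Real.exp_pos (-(z.re*y))
  have h2 := bern_p2 z.re y hx hy
  have h4 := Real.one_sub_sq_div_two_le_cos (x := z.im*y)
  have h5 := mul_le_mul_of_nonneg_left h4 h3.le
  have h6 := mul_le_mul_of_nonneg_left h2 (sq_nonneg z.im)
  have e : z.im^2 * (2/z.re^2 * (1 - Real.exp (-(z.re*y)))) = 2 * (z.im^2/z.re^2 * (1 - Real.exp (-(z.re*y)))) := by ring
  rw [e] at h6
  nlinarith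

lemma bern_im_hi (z : ℂ) (y : ℝ) (hx : 0 < z.re) (hy : 0 < y) : |(1 - Complex.exp (-(z * (y:ℂ)))).im|
    ≤ (|z.im|/z.re) * (1 - Real.exp (-(z.re*y))) := by
  rw [bern_im, abs_mul, Real.abs_exp]
  have h3 := Real.exp_pos (-(z.re*y))
  have h2 := bern_p1 z.re y hx
  have h4 : |Real.sin (z.im*y)| ≤ |z.im| * y := by
    have := Real.abs_sin_le_abs (x := z.im*y)
    rwa [abs_mul, abs_of_pos hy] at this
  have h5 := mul_le_mul_of_nonneg_left h4 h3.le
  have h6 := mul_le_mul_of_nonneg_left h2 (abs_nonneg z.im)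
  have e : |z.im| * (1/z.re * (1 - Real.exp (-(z.re*y)))) = (|z.im|/z.re * (1 - Real.exp (-(z.re*y)))) := by ring
  rw [e] at h6
  nlinarith

lemma bern_aepos (μ : Measure ℝ) (hμ0 : μ (Set.Iic 0) = 0) : ∀ᵐ y ∂μ, 0 < y := by
  rw [ae_iff]; convert hμ0 using 2; ext; simp

lemma bern_intE (μ : Measure ℝ) (hμ0 : μ (Set.Iic 0) = 0)
    (hμint : Integrable (fun y : ℝ => min 1 y) μ) (x : ℝ) (hx : 0 < x) :
    Integrable (fun y => 1 - Real.exp (-(x*y))) μ := by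
  refine Integrable.mono' (hμint.const_mul (1 + x)) (by fun_prop) ?_
  filter_upwards [bern_aepos μ hμ0] with y hy
  have h3 := Real.exp_pos (-(x*y))
  have h4 := Real.add_one_le_exp (-(x*y))
  have h5 : Real.exp (-(x*y)) ≤ 1 := Real.exp_le_one_iff.2 (by nlinarith)
  rw [Real.norm_of_nonneg (by linarith)]
  rcases le_total 1 y with h | h
  · rw [min_eq_left h]; linarith
  · rw [min_eq_right h]; nlinarith

lemma bern_int0 (μ : Measure ℝ) (hμ0 : μ (Set.Iic 0) = 0)
    (hμint : Integrable (fun y : ℝ => min 1 y) μ) (z : ℂ) (hz : 0 < z.re) :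
    Integrable (fun y : ℝ => 1 - Complex.exp (-(z * (y:ℂ)))) μ := by
  refine Integrable.mono' ((bern_intE μ hμ0 hμint z.re hz).const_mul ((1 + z.im^2/z.re^2) + |z.im|/z.re))
    (by fun_prop) ?_
  filter_upwards [bern_aepos μ hμ0] with y hy
  have h5 : Real.exp (-(z.re*y)) ≤ 1 := Real.exp_le_one_iff.2 (by nlinarith)
  have := Complex.norm_le_abs_re_add_abs_im (1 - Complex.exp (-(z * (y:ℂ))))
  have h1 := bern_re_hi z y hz hy
  have h2 := bern_im_hi z y hz hy
  rw [abs_of_nonneg (by have := bern_re_lo z y; linarith)] at this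
  linarith

lemma bern_n1 (z : ℂ) (y : ℝ) (hx : 0 < z.re) (hy : 0 < y) : ‖(y:ℂ) * Complex.exp (-(z * (y:ℂ)))‖
    ≤ 1/z.re * (1 - Real.exp (-(z.re*y))) := by
  rw [norm_mul, bern_normexp, Complex.norm_of_nonneg hy.le]
  exact bern_p1 _ _ hx

lemma bern_n2 (z : ℂ) (y : ℝ) (hx : 0 < z.re) (hy : 0 < y) : ‖-((y:ℂ)^2 * Complex.exp (-(z * (y:ℂ))))‖
    ≤ 2/z.re^2 * (1 - Real.exp (-(z.re*y))) := by
  rw [norm_neg, norm_mul, bern_normexp, norm_pow, Complex.norm_of_nonneg hy.le]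
  exact bern_p2 _ _ hx hy

lemma bern_int1 (μ : Measure ℝ) (hμ0 : μ (Set.Iic 0) = 0)
    (hμint : Integrable (fun y : ℝ => min 1 y) μ) (z : ℂ) (hz : 0 < z.re) :
    Integrable (fun y : ℝ => (y:ℂ) * Complex.exp (-(z * (y:ℂ)))) μ := by
  refine Integrable.mono' ((bern_intE μ hμ0 hμint z.re hz).const_mul (1/z.re)) (by fun_prop) ?_
  filter_upwards [bern_aepos μ hμ0] with y hy using bern_n1 z y hz hy

lemma bern_re_ball (z w : ℂ) (hw : w ∈ Metric.ball z (z.re/2)) : z.re/2 < w.re := by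
  have h1 := Complex.abs_re_le_norm (w - z)
  rw [Metric.mem_ball, dist_eq_norm] at hw
  have := (abs_le.1 (h1.trans hw.le)).1
  have h3 := (abs_lt.1 (h1.trans_lt hw)).1
  simp at h3
  linarith

lemma bern_D1 (μ : Measure ℝ) (hμ0 : μ (Set.Iic 0) = 0)
    (hμint : Integrable (fun y : ℝ => min 1 y) μ) (z : ℂ) (hz : 0 < z.re) :
    HasDerivAt (fun z : ℂ => ∫ y : ℝ, (1 - Complex.exp (-(z * (y:ℂ)))) ∂μ)
      (∫ y : ℝ, (y:ℂ) * Complex.exp (-(z * (y:ℂ))) ∂μ) z := by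
  refine (hasDerivAt_integral_of_dominated_loc_of_deriv_le
    (F := fun (z : ℂ) (y : ℝ) => 1 - Complex.exp (-(z * (y:ℂ))))
    (F' := fun (z : ℂ) (y : ℝ) => (y:ℂ) * Complex.exp (-(z * (y:ℂ))))
    (bound := fun y => 1/(z.re/2) * (1 - Real.exp (-(z.re/2*y))))
    (s := Metric.ball z (z.re/2)) (Metric.ball_mem_nhds _ (by positivity)) 
    (Filter.Eventually.of_forall fun w => by fun_prop) (bern_int0 μ hμ0 hμint z hz)
    (by fun_prop) ?_ ((bern_intE μ hμ0 hμint (z.re/2) (by positivity)).const_mul _) ?_).2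
  · filter_upwards [bern_aepos μ hμ0] with y hy w hw
    have := bern_re_ball z w hw
    rw [norm_mul, bern_normexp, Complex.norm_of_nonneg hy.le]
    refine le_trans ?_ (bern_p1 _ _ (by positivity))
    gcongr
  · refine Filter.Eventually.of_forall fun y w hw => ?_
    have h : HasDerivAt (fun w : ℂ => -(w * (y:ℂ))) (-(1 * (y:ℂ))) w := ((hasDerivAt_id w).mul_const _).neg
    convert h.cexp.const_sub 1 using 1
    ring

lemma bern_D2 (μ : Measure ℝ) (hμ0 : μ (Set.Iic 0) = 0)
    (hμint : Integrable (fun y : ℝ => min 1 y) μ) (z : ℂ) (hz : 0 < z.re) :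
    HasDerivAt (fun z : ℂ => ∫ y : ℝ, (y:ℂ) * Complex.exp (-(z * (y:ℂ))) ∂μ)
      (∫ y : ℝ, -((y:ℂ)^2 * Complex.exp (-(z * (y:ℂ)))) ∂μ) z := by
  refine (hasDerivAt_integral_of_dominated_loc_of_deriv_le
    (F := fun (z : ℂ) (y : ℝ) => (y:ℂ) * Complex.exp (-(z * (y:ℂ))))
    (F' := fun (z : ℂ) (y : ℝ) => -((y:ℂ)^2 * Complex.exp (-(z * (y:ℂ)))))
    (bound := fun y => 2/(z.re/2)^2 * (1 - Real.exp (-(z.re/2*y))))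
    (s := Metric.ball z (z.re/2)) (Metric.ball_mem_nhds _ (by positivity)) 
    (Filter.Eventually.of_forall fun w => by fun_prop) (bern_int1 μ hμ0 hμint z hz)
    (by fun_prop) ?_ ((bern_intE μ hμ0 hμint (z.re/2) (by positivity)).const_mul _) ?_).2
  · filter_upwards [bern_aepos μ hμ0] with y hy w hw
    have := bern_re_ball z w hw
    rw [norm_neg, norm_mul, bern_normexp, norm_pow, Complex.norm_of_nonneg hy.le]
    refine le_trans ?_ (bern_p2 _ _ (by positivity) hy)
    gcongr
  · refine Filter.Eventually.of_forall fun y w hw => ?_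
    have h : HasDerivAt (fun w : ℂ => -(w * (y:ℂ))) (-(1 * (y:ℂ))) w := ((hasDerivAt_id w).mul_const _).neg
    exact (h.cexp.const_mul (y:ℂ)).congr_deriv (by ring)

/-- All needed facts on the extended function. -/
lemma bern_facts (m σ2 : ℝ) (μ : Measure ℝ)
    (hm : 0 ≤ m) (hσ : 0 ≤ σ2)
    (hμ0 : μ (Set.Iic 0) = 0)
    (hμint : Integrable (fun y : ℝ => min 1 y) μ)
    (hnd : ¬ (m = 0 ∧ σ2 = 0 ∧ μ = 0)) (F0 : ℂ → ℂ)
    (hF0 : F0 = fun z => (m : ℂ) + (σ2 : ℂ) * z + ∫ y, (1 - Complex.exp (-(z * (y : ℂ)))) ∂μ) :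
    ∃ (F1 F2 : ℂ → ℂ), ∀ z : ℂ, 0 < z.re → HasDerivAt F0 (F1 z) z ∧ HasDerivAt F1 (F2 z) z
      ∧ 0 < (F0 z.re).re ∧ (F0 z.re).re ≤ (F0 z).re ∧ (F0 z).re ≤ (1 + z.im^2/z.re^2) * (F0 z.re).re
      ∧ |(F0 z).im| ≤ |z.im|/z.re * (F0 z.re).re
      ∧ ‖F1 z‖ ≤ 1/z.re * (F0 z.re).re ∧ ‖F2 z‖ ≤ 2/z.re^2 * (F0 z.re).re := by
  have hq : ∀ x : ℝ, 0 < x → (F0 x).re = m + σ2 * x + ∫ y, (1 - Real.exp (-(x*y))) ∂μ := by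
    intro x hx
    have : (∫ y:ℝ, (1 - Complex.exp (-((x:ℂ) * (y : ℂ)))) ∂μ) = ((∫ y, (1 - Real.exp (-(x*y))) ∂μ : ℝ) : ℂ) := by
      rw [← integral_complex_ofReal]; congr 1; ext y; push_cast; rfl
    rw [hF0]; simp only [this]; simp
  refine ⟨fun z => σ2 + ∫ y : ℝ, (y:ℂ) * Complex.exp (-(z * (y:ℂ))) ∂μ,
    fun z => ∫ y : ℝ, -((y:ℂ)^2 * Complex.exp (-(z * (y:ℂ)))) ∂μ, fun z hz => ?_⟩
  have iE := bern_intE μ hμ0 hμint z.re hz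
  have i0 := bern_int0 μ hμ0 hμint z hz
  have hEn : ∀ᵐ y ∂μ, 0 ≤ 1 - Real.exp (-(z.re*y)) := by
    filter_upwards [bern_aepos μ hμ0] with y hy
    have h5 : Real.exp (-(z.re*y)) ≤ 1 := Real.exp_le_one_iff.2 (by nlinarith)
    linarith
  have qn := integral_nonneg_of_ae hEn
  have hre : (F0 z).re = m + σ2 * z.re + ∫ y, (1 - Complex.exp (-(z * (y : ℂ)))).re ∂μ := by
    have := integral_re i0
    simp only [RCLike.re_to_complex] at this
    rw [hF0, this]; simp
  have him : (F0 z).im = σ2 * z.im + ∫ y, (1 - Complex.exp (-(z * (y : ℂ)))).im ∂μ := by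
    have := integral_im i0
    simp only [RCLike.im_to_complex] at this
    rw [hF0, this]; simp
  rw [hre, him, hq z.re hz]
  set q := ∫ y, (1 - Real.exp (-(z.re*y))) ∂μ with hqd
  have hs : 0 ≤ σ2 * z.re := by positivity
  refine ⟨?_, ?_, ?_, ?_, ?_, ?_, ?_, ?_⟩
  · rw [hF0]
    have h1 : HasDerivAt (fun z : ℂ => (m:ℂ) + σ2 * z) ((σ2:ℂ) * 1) z :=
      ((hasDerivAt_id z).const_mul _).const_add _
    rw [mul_one] at h1
    exact h1.add (bern_D1 μ hμ0 hμint z hz)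
  · exact (bern_D2 μ hμ0 hμint z hz).const_add _
  · by_contra hcon
    have qn' : 0 ≤ q := qn
    have hm0 : m = 0 := by linarith
    have hs0 : σ2 * z.re = 0 := by linarith
    have hq0 : q = 0 := by linarith
    refine hnd ⟨hm0, by simpa [hz.ne'] using hs0, ?_⟩
    have := (integral_eq_zero_iff_of_nonneg_ae hEn iE).1 hq0
    rw [← ae_eq_bot, ← Filter.eventually_false_iff_eq_bot]
    filter_upwards [this, bern_aepos μ hμ0] with y hy hy0
    have hlt : Real.exp (-(z.re*y)) < 1 := Real.exp_lt_one_iff.2 (by nlinarith)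
    simp only [Pi.zero_apply] at hy
    linarith
  · have := integral_mono iE i0.re (fun y => by simpa using bern_re_lo z y)
    simp only [RCLike.re_to_complex] at this
    linarith
  · have := integral_mono_ae i0.re (iE.const_mul (1 + z.im^2/z.re^2)) (by
      filter_upwards [bern_aepos μ hμ0] with y hy using bern_re_hi z y hz hy)
    simp only [RCLike.re_to_complex, integral_const_mul] at this
    have hp : 0 ≤ z.im^2/z.re^2 := by positivity
    nlinarith
  · have := norm_integral_le_of_norm_le (f := fun y : ℝ => (1 - Complex.exp (-(z * (y : ℂ)))).im)
      (iE.const_mul (|z.im|/z.re)) (by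
      filter_upwards [bern_aepos μ hμ0] with y hy using bern_im_hi z y hz hy)
    rw [integral_const_mul, Real.norm_eq_abs] at this
    refine (abs_add_le _ _).trans ?_
    rw [abs_mul, abs_of_nonneg hσ]
    have e : |z.im|/z.re * (m + σ2 * z.re + q) = |z.im|/z.re*m + σ2 * |z.im| + |z.im|/z.re * q := by
      field_simp
    have : 0 ≤ |z.im|/z.re*m := by positivity
    linarith
  · have := norm_integral_le_of_norm_le (iE.const_mul (1/z.re)) (by
      filter_upwards [bern_aepos μ hμ0] with y hy using bern_n1 z y hz hy)
    rw [integral_const_mul] at this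
    refine (norm_add_le _ _).trans ?_
    rw [Complex.norm_of_nonneg hσ]
    have e : 1/z.re * (m + σ2 * z.re + q) = 1/z.re*m + σ2 + 1/z.re * q := by
      field_simp
    have : 0 ≤ 1/z.re*m := by positivity
    linarith
  · have := norm_integral_le_of_norm_le (iE.const_mul (2/z.re^2)) (by
      filter_upwards [bern_aepos μ hμ0] with y hy using bern_n2 z y hz hy)
    rw [integral_const_mul] at this
    refine this.trans ?_
    gcongr
    linarith

lemma bern_log (F0 F1 F2 : ℂ → ℂ) (hF : ∀ z : ℂ, 0 < z.re → HasDerivAt F0 (F1 z) z ∧ HasDerivAt F1 (F2 z) z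
      ∧ 0 < (F0 z.re).re ∧ (F0 z.re).re ≤ (F0 z).re ∧ (F0 z).re ≤ (1 + z.im^2/z.re^2) * (F0 z.re).re
      ∧ |(F0 z).im| ≤ |z.im|/z.re * (F0 z.re).re
      ∧ ‖F1 z‖ ≤ 1/z.re * (F0 z.re).re ∧ ‖F2 z‖ ≤ 2/z.re^2 * (F0 z.re).re) (s : ℝ) :
    ∃ H1 H2 : ℝ → ℝ, ∀ x : ℝ, 0 < x →
      HasDerivAt (fun x : ℝ => Real.log ‖F0 ((x:ℂ) + s * Complex.I)‖) (H1 x) x ∧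
      HasDerivAt H1 (H2 x) x ∧ |H2 x| ≤ 3/x^2 := by
  refine ⟨fun x => (F1 ((x:ℂ) + s * Complex.I) / F0 ((x:ℂ) + s * Complex.I)).re,
    fun x => ((F2 ((x:ℂ) + s * Complex.I) * F0 ((x:ℂ) + s * Complex.I)
      - F1 ((x:ℂ) + s * Complex.I) * F1 ((x:ℂ) + s * Complex.I)) / F0 ((x:ℂ) + s * Complex.I)^2).re,
    fun x hx => ?_⟩
  have hre : ((x:ℂ) + s * Complex.I).re = x := by simp
  obtain ⟨d0, d1, p0, p1, -, -, n1, n2⟩ := hF ((x:ℂ) + s * Complex.I) (by rw [hre]; exact hx)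
  rw [hre] at p0 p1 n1 n2
  set p := (F0 x).re
  set z := (x:ℂ) + s * Complex.I with hz
  have hpos : 0 < (F0 z).re := by linarith
  have hne : F0 z ≠ 0 := by intro h; rw [h] at hpos; simp at hpos
  have hnorm : p ≤ ‖F0 z‖ := p1.trans (Complex.re_le_norm _)
  have htr : HasDerivAt (fun w : ℂ => w + s * Complex.I) 1 (x:ℂ) := (hasDerivAt_id _).add_const _
  refine ⟨?_, ?_, ?_⟩
  · have l := d0.clog (Or.inl hpos)
    have := (HasDerivAt.comp (x:ℂ) (h₂ := fun z => Complex.log (F0 z)) l htr).real_of_complex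
    simp only [Function.comp, Complex.log_re, mul_one] at this
    exact this
  · have l := d1.div d0 hne
    have := (HasDerivAt.comp (x:ℂ) (h₂ := fun z => F1 z / F0 z) l htr).real_of_complex
    simp only [Function.comp, mul_one] at this
    exact this
  · refine (Complex.abs_re_le_norm _).trans ?_
    rw [norm_div, norm_pow, div_le_iff₀ (by positivity)]
    refine (norm_sub_le _ _).trans ?_
    rw [norm_mul, norm_mul]
    set N := ‖F0 z‖
    have a1 : ‖F2 z‖ * N ≤ 2/x^2 * N * N := by
      gcongr
      exact n2.trans (by gcongr)
    have n1' : ‖F1 z‖ ≤ 1/x * N := n1.trans (by gcongr)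
    have a2 : ‖F1 z‖ * ‖F1 z‖ ≤ (1/x * N) * (1/x*N) := by gcongr
    refine (add_le_add a1 a2).trans (le_of_eq ?_)
    field_simp
    ring

lemma bern_conv (h H1 H2 : ℝ → ℝ) (d1 : ∀ x, 0 < x → HasDerivAt h (H1 x) x)
    (d2 : ∀ x, 0 < x → HasDerivAt H1 (H2 x) x) (hb : ∀ x, 0 < x → -(6/x^2) ≤ H2 x) :
    ConvexOn ℝ (Set.Ioi 0) (fun x => h x - 6 * Real.log x) := by
  have e1 : ∀ x, 0 < x → HasDerivAt (fun x => h x - 6 * Real.log x) (H1 x - 6 * x⁻¹) x :=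
    fun x hx => (d1 x hx).sub ((Real.hasDerivAt_log hx.ne').const_mul 6)
  refine convexOn_of_hasDerivWithinAt2_nonneg (f' := fun x => H1 x - 6 * x⁻¹)
    (f'' := fun x => H2 x - 6 * (-(x^2)⁻¹)) (convex_Ioi 0)
    (fun x hx => (e1 x hx).continuousAt.continuousWithinAt) ?_ ?_ ?_
  all_goals rw [interior_Ioi]; intro x hx
  · exact (e1 x hx).hasDerivWithinAt
  · exact ((d2 x hx).sub ((hasDerivAt_inv (ne_of_gt hx)).const_mul 6)).hasDerivWithinAt
  · have := hb x hx
    rw [div_eq_mul_inv] at this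
    linarith

/-- convergence of `L(a,b) = ∏_{k≥1} φ(a+k)/|φ(a+k+ib)|` and the two-sided
estimate `e^{-19/(8a)} ≤ √(φ(a)/|φ(a+ib)|) e^{bΘ_φ(a,b)} L(a,b) ≤ e^{19/(8a)}`. -/
theorem bernstein_product_two_sided_estimate
    (φC : ℂ → ℂ) (m σ2 : ℝ) (μ : Measure ℝ)
    (hm : 0 ≤ m) (hσ : 0 ≤ σ2)
    (hμ0 : μ (Set.Iic 0) = 0)
    (hμint : Integrable (fun y : ℝ => min 1 y) μ)
    (hrepC : ∀ z : ℂ, 0 ≤ z.re →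
      φC z = (m : ℂ) + (σ2 : ℂ) * z + ∫ y, (1 - Complex.exp (-(z * (y : ℂ)))) ∂μ)
    (hnd : ¬ (m = 0 ∧ σ2 = 0 ∧ μ = 0)) :
    ∀ a b : ℝ, 0 < a → 0 < b →
      ∃ L : ℝ, 0 < L
        ∧ Filter.Tendsto (fun n : ℕ => ∏ k ∈ Finset.range n,
            (φC (((a + (k : ℝ) + 1 : ℝ) : ℂ))).re
              / ‖φC (((a + (k : ℝ) + 1 : ℝ) : ℂ) + (b : ℂ) * Complex.I)‖)
          Filter.atTop (nhds L)
        ∧ Real.exp (-(19 / (8 * a)))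
            ≤ Real.sqrt ((φC (a : ℂ)).re / ‖φC ((a : ℂ) + (b : ℂ) * Complex.I)‖)
                * Real.exp (b * Theta φC a b) * L
        ∧ Real.sqrt ((φC (a : ℂ)).re / ‖φC ((a : ℂ) + (b : ℂ) * Complex.I)‖)
              * Real.exp (b * Theta φC a b) * L
            ≤ Real.exp (19 / (8 * a)) := by
  intro a b a0 b0
  set F0 : ℂ → ℂ := fun z => (m : ℂ) + (σ2 : ℂ) * z + ∫ y, (1 - Complex.exp (-(z * (y : ℂ)))) ∂μ with hF0
  have hφ : ∀ z : ℂ, 0 < z.re → φC z = F0 z := fun z hz => hrepC z hz.le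
  obtain ⟨F1, F2, hF⟩ := bern_facts m σ2 μ hm hσ hμ0 hμint hnd F0 hF0
  have hRe : ∀ x : ℝ, ((x:ℂ) + (b:ℂ) * Complex.I).re = x := by intro x; simp
  have hIm : ∀ x : ℝ, ((x:ℂ) + (b:ℂ) * Complex.I).im = b := by intro x; simp
  have hφ1 : ∀ x : ℝ, 0 < x → φC x = F0 x := fun x hx => hφ _ (by simpa using hx)
  have hφ2 : ∀ x : ℝ, 0 < x → φC ((x:ℂ) + (b:ℂ) * Complex.I) = F0 ((x:ℂ) + (b:ℂ) * Complex.I) :=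
    fun x hx => hφ _ (by rw [hRe]; exact hx)
  have hpos : ∀ x : ℝ, 0 < x → 0 < (F0 x).re := fun x hx => by
    have := (hF (x:ℂ) (by simpa using hx)).2.2.1
    simpa using this
  have hge : ∀ x : ℝ, 0 < x → (F0 x).re ≤ ‖F0 ((x:ℂ) + (b:ℂ) * Complex.I)‖ := fun x hx => by
    have := (hF ((x:ℂ) + (b:ℂ) * Complex.I) (by rw [hRe]; exact hx)).2.2.2.1
    rw [hRe] at this
    exact this.trans (Complex.re_le_norm _)
  have hreal : ∀ x : ℝ, 0 < x → ‖F0 x‖ = (F0 x).re := fun x hx => by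
    have := (hF (x:ℂ) (by simpa using hx)).2.2.2.2.2.1
    simp only [Complex.ofReal_im, abs_zero, zero_div, zero_mul] at this
    have h0 : (F0 x).im = 0 := abs_eq_zero.1 (le_antisymm this (abs_nonneg _))
    have e : F0 x = (((F0 x).re : ℝ) : ℂ) := Complex.ext (by simp) (by simpa using h0)
    rw [e, Complex.norm_of_nonneg (hpos x hx).le]; simp
  set h : ℝ → ℝ := fun x => Real.log ‖F0 ((x:ℂ) + (b:ℂ) * Complex.I)‖ - Real.log ‖F0 ((x:ℂ) + ((0:ℝ):ℂ) * Complex.I)‖ with hh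
  have hh' : ∀ x, 0 < x → h x = Real.log (‖F0 ((x:ℂ) + (b:ℂ) * Complex.I)‖ / (F0 x).re) := fun x hx => by
    have := hpos x hx
    have := hge x hx
    rw [Real.log_div (by linarith) (by linarith), hh]
    simp only [Complex.ofReal_zero, zero_mul, add_zero]
    rw [hreal x hx]
  obtain ⟨A1, A2, hA⟩ := bern_log F0 F1 F2 hF b
  obtain ⟨B1, B2, hB⟩ := bern_log F0 F1 F2 hF 0
  have d1 : ∀ x, 0 < x → HasDerivAt h (A1 x - B1 x) x := fun x hx => (hA x hx).1.sub (hB x hx).1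
  have d2 : ∀ x, 0 < x → HasDerivAt (fun x => A1 x - B1 x) (A2 x - B2 x) x :=
    fun x hx => (hA x hx).2.1.sub (hB x hx).2.1
  have hb2 : ∀ x, 0 < x → |A2 x - B2 x| ≤ 6/x^2 := fun x hx => by
    refine (abs_sub _ _).trans ((add_le_add (hA x hx).2.2 (hB x hx).2.2).trans (le_of_eq ?_))
    ring
  have c1 := bern_conv h _ _ d1 d2 (fun x hx => (abs_le.1 (hb2 x hx)).1)
  have c2 := bern_conv (fun x => -h x) _ _ (fun x hx => (d1 x hx).neg) (fun x hx => (d2 x hx).neg)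
    (fun x hx => by have := (abs_le.1 (hb2 x hx)).2; linarith)
  have hC : ∀ x, a ≤ x → h x ≤ ((3*b^2 + b^4/a^2)/2) / x^2 := fun x hax => by
    have hx : 0 < x := a0.trans_le hax
    obtain ⟨-, -, -, lo, r, i, -, -⟩ := hF ((x:ℂ) + (b:ℂ) * Complex.I) (by rw [hRe]; exact hx)
    rw [hRe] at lo
    rw [hRe, hIm] at r i
    rw [abs_of_pos b0] at i
    have hp := hpos x hx
    have hg := hge x hx
    rw [hh' x hx]
    set p := (F0 x).re
    set w := F0 ((x:ℂ) + (b:ℂ) * Complex.I)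
    have hw : ‖w‖^2 ≤ ((1+b^2/x^2)^2 + (b/x)^2) * p^2 := by
      have : ‖w‖^2 = w.re^2 + w.im^2 := by
        rw [← Complex.normSq_eq_norm_sq, Complex.normSq_apply]; ring
      rw [this, ← sq_abs w.im]
      have r2 : w.re^2 ≤ ((1+b^2/x^2)*p)^2 := pow_le_pow_left₀ (hp.le.trans lo) r 2
      have i2 : |w.im|^2 ≤ (b/x*p)^2 := pow_le_pow_left₀ (abs_nonneg _) i 2
      linarith
    have ht : 0 < ‖w‖ / p := div_pos (by linarith) hp
    have ht2 : (‖w‖/p)^2 ≤ (1+b^2/x^2)^2 + (b/x)^2 := by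
      rw [div_pow, div_le_iff₀ (by positivity)]; exact hw
    have hl := Real.log_le_sub_one_of_pos (show 0 < (‖w‖/p)^2 by positivity)
    rw [Real.log_pow] at hl
    push_cast at hl
    have e : (1+b^2/x^2)^2 + (b/x)^2 - 1 = (3*b^2 + b^4/x^2)/x^2 := by field_simp; ring
    have e2 : (3*b^2 + b^4/x^2)/x^2 ≤ (3*b^2 + b^4/a^2)/x^2 := by gcongr
    have e3 : ((3*b^2 + b^4/a^2)/2) / x^2 = ((3*b^2 + b^4/a^2) / x^2)/2 := by ring
    rw [e3]
    linarith
  have h0 : ∀ x, 0 < x → 0 ≤ h x := fun x hx => by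
    rw [hh' x hx]
    exact Real.log_nonneg ((one_le_div (hpos x hx)).2 (hge x hx))
  obtain ⟨S, tS, hS⟩ := bern_core h (fun x hx => (d1 x hx).continuousAt.continuousWithinAt) c1 c2 a a0 h0 _ hC
  have hinv : ∀ x : ℝ, 0 < x → (φC x).re / ‖φC ((x:ℂ) + (b:ℂ) * Complex.I)‖ = Real.exp (-h x) := fun x hx => by
    have := hpos x hx
    have := hge x hx
    rw [hφ1 x hx, hφ2 x hx, hh' x hx, ← Real.log_inv, inv_div, Real.exp_log (div_pos (by linarith) (by linarith))]
  have hTheta : b * Theta φC a b = ∫ x in Set.Ioi a, h x := by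
    have e : Theta φC a b = ∫ u in Set.Ioi (a/b), h (b*u) := by
      unfold Theta
      refine setIntegral_congr_fun measurableSet_Ioi fun u hu => ?_
      have hu' : a / b < u := hu
      have hbu : 0 < b * u := mul_pos b0 ((div_pos a0 b0).trans hu')
      rw [hh' _ hbu, hφ1 _ hbu, hφ2 _ hbu]
    rw [e, integral_comp_mul_left_Ioi _ _ b0, smul_eq_mul, mul_div_cancel₀ _ b0.ne', ← mul_assoc,
      mul_inv_cancel₀ b0.ne', one_mul]
  have hsq : Real.sqrt (Real.exp (-h a)) = Real.exp (-h a/2) := (Real.exp_half _).symm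
  rw [hinv a a0, hTheta, hsq]
  refine ⟨Real.exp (-S), Real.exp_pos _, ?_, ?_, ?_⟩
  · have := (Real.continuous_exp.tendsto _).comp tS.neg
    refine this.congr fun n => ?_
    simp only [Function.comp]
    rw [← Finset.sum_neg_distrib, Real.exp_sum]
    refine Finset.prod_congr rfl fun k _ => ?_
    rw [hinv (a+k+1) (by positivity)]
  all_goals
    rw [← Real.exp_add, ← Real.exp_add, Real.exp_le_exp]
    have := abs_le.1 hS
    linarith [this.1, this.2]
end

section
/- Let φ be a Bernstein function of class B_N with σ² = 0, and suppose Π̄̄(y) = ∫_y^∞ Π̄(r) dr satisfies Π̄̄(y) ~ C̄ y^{−α} as y ↓ 0, for some C̄ > 0 and α ∈ (0,1). Then: (i) for every fixed a > 0, lim_{b→∞} b^{−α} φ(a b + i b) = C̄ Γ(1−α) (a + i)^α (principal branch) and lim_{b→∞} b^{−α} φ(a b) = C̄ Γ(1−α) a^α; (ii) lim_{b→∞} Θ_φ(0,b) = (π/2)·α, where Θ_φ(0,b) = ∫_0^∞ log( |φ(b u + i b)| / φ(b u) ) du. (Paper: Theorem on Mellin estimates, item on the class N_α: H = (π/2)α.)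 -/
open MeasureTheory

lemma aux_deriv (x : ℝ) (hx : 0 < x) :
    HasDerivAt (fun u : ℝ => u * Real.log (1 + u^2) - 2 * (u * Real.log u) + 2 * Real.arctan u)
      (Real.log (1 + 1 / x^2)) x := by
  have h1 : HasDerivAt (fun u : ℝ => 1 + u^2) (2 * x) x := by
    simpa using ((hasDerivAt_pow 2 x).const_add 1)
  have h2 := h1.log (by positivity)
  have h3 := (hasDerivAt_id x).mul h2
  have h4 := (hasDerivAt_id x).mul (Real.hasDerivAt_log hx.ne')
  have h5 := (Real.hasDerivAt_arctan x).const_mul 2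
  have h := (h3.sub (h4.const_mul 2)).add h5
  refine h.congr_deriv ?_
  have : Real.log (1 + 1 / x^2) = Real.log (1 + x^2) - 2 * Real.log x := by
    have e : 1 + 1 / x^2 = (1 + x^2) / x^2 := by field_simp; ring
    rw [e, Real.log_div (by positivity) (by positivity), Real.log_pow]; push_cast; ring
  rw [this]
  simp only [id]
  field_simp
  ring

lemma aux_log_nonneg (x : ℝ) : 0 ≤ Real.log (1 + 1 / x^2) :=
  Real.log_nonneg (by have : 0 ≤ 1 / x^2 := by positivity
                      linarith)

lemma aux_lim : Filter.Tendsto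
    (fun u : ℝ => u * Real.log (1 + u^2) - 2 * (u * Real.log u) + 2 * Real.arctan u)
    Filter.atTop (nhds Real.pi) := by
  have h1 : Filter.Tendsto (fun u : ℝ => u * Real.log (1 + 1 / u^2)) Filter.atTop (nhds 0) := by
    refine tendsto_of_tendsto_of_tendsto_of_le_of_le' tendsto_const_nhds tendsto_inv_atTop_zero ?_ ?_
    · filter_upwards [Filter.eventually_gt_atTop 0] with u hu
      exact mul_nonneg hu.le (aux_log_nonneg u)
    · filter_upwards [Filter.eventually_gt_atTop 0] with u hu
      have := Real.log_le_sub_one_of_pos (x := 1 + 1 / u^2) (by positivity)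
      calc u * Real.log (1 + 1 / u^2) ≤ u * (1 / u^2) := by gcongr; linarith
        _ = u⁻¹ := by field_simp
  have h2 : Filter.Tendsto (fun u : ℝ => 2 * Real.arctan u) Filter.atTop (nhds (2 * (Real.pi / 2))) :=
    (Real.tendsto_arctan_atTop.mono_right nhdsWithin_le_nhds).const_mul 2
  have h3 := h1.add h2
  rw [show 0 + 2 * (Real.pi / 2) = Real.pi by ring] at h3
  refine h3.congr' ?_
  filter_upwards [Filter.eventually_gt_atTop 0] with u hu
  have : Real.log (1 + 1 / u^2) = Real.log (1 + u^2) - 2 * Real.log u := by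
    have e : 1 + 1 / u^2 = (1 + u^2) / u^2 := by field_simp; ring
    rw [e, Real.log_div (by positivity) (by positivity), Real.log_pow]; push_cast; ring
  rw [this]; ring

lemma aux_cont : Continuous
    (fun u : ℝ => u * Real.log (1 + u^2) - 2 * (u * Real.log u) + 2 * Real.arctan u) := by
  have h1 : Continuous (fun u : ℝ => Real.log (1 + u^2)) :=
    Continuous.log (by fun_prop) (fun x => by positivity)
  exact ((continuous_id.mul h1).sub (Real.continuous_mul_log.const_mul 2)).add
    (Real.continuous_arctan.const_mul 2)

lemma aux_integrable : IntegrableOn (fun u : ℝ => Real.log (1 + 1 / u^2)) (Set.Ioi 0) :=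
  integrableOn_Ioi_deriv_of_nonneg aux_cont.continuousWithinAt (fun x hx => aux_deriv x hx)
    (fun x _ => aux_log_nonneg x) aux_lim

lemma aux_integral : ∫ u in Set.Ioi (0:ℝ), Real.log (1 + 1 / u^2) = Real.pi := by
  rw [integral_Ioi_of_hasDerivAt_of_nonneg aux_cont.continuousWithinAt (fun x hx => aux_deriv x hx)
    (fun x _ => aux_log_nonneg x) aux_lim]
  simp

lemma aux_norm (w : ℂ) (hw : 0 ≤ w.re) : ‖1 - Complex.exp (-w)‖ ≤ 2 * min 1 ‖w‖ := by
  have h2 : ‖1 - Complex.exp (-w)‖ ≤ 2 := by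
    calc _ ≤ ‖(1:ℂ)‖ + ‖Complex.exp (-w)‖ := norm_sub_le _ _
      _ ≤ 1 + 1 := by
        gcongr
        · simp
        · rw [Complex.norm_exp]; simpa using hw
      _ = 2 := by norm_num
  rcases le_total 1 ‖w‖ with h | h
  · rw [min_eq_left h]; linarith
  · rw [min_eq_right h, norm_sub_rev]
    simpa using Complex.norm_exp_sub_one_le (x := -w) (by simpa using h)

section
variable {Pib : ℝ → ℝ}

lemma aux_meas (hPint : IntegrableOn (fun y : ℝ => min 1 y * Pib y) (Set.Ioi 0)) :
    AEStronglyMeasurable Pib (volume.restrict (Set.Ioi 0)) := by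
  have h1 : AEStronglyMeasurable (fun y : ℝ => (min 1 y)⁻¹) (volume.restrict (Set.Ioi 0)) :=
    (Measurable.inv (by fun_prop)).aestronglyMeasurable
  refine (h1.mul hPint.aestronglyMeasurable).congr ?_
  filter_upwards [ae_restrict_mem measurableSet_Ioi] with y hy
  have : 0 < min 1 y := lt_min one_pos hy
  simp only [Pi.mul_apply]
  field_simp

lemma aux_int_of_bound
    (hPint : IntegrableOn (fun y : ℝ => min 1 y * Pib y) (Set.Ioi 0))
    {E : Type*} [NormedAddCommGroup E] (g : ℝ → E) (C : ℝ)
    (hg : AEStronglyMeasurable g (volume.restrict (Set.Ioi 0)))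
    (hb : ∀ y, 0 < y → ‖g y‖ ≤ C * (min 1 y * Pib y)) :
    IntegrableOn g (Set.Ioi 0) := by
  refine Integrable.mono' (hPint.const_mul C) hg ?_
  filter_upwards [ae_restrict_mem measurableSet_Ioi] with y hy
  exact hb y hy

lemma aux_int_Ioi (hnn : ∀ y : ℝ, 0 < y → 0 ≤ Pib y)
    (hPint : IntegrableOn (fun y : ℝ => min 1 y * Pib y) (Set.Ioi 0)) (r : ℝ) (hr : 0 < r) :
    IntegrableOn Pib (Set.Ioi r) := by
  have hsub : Set.Ioi r ⊆ Set.Ioi 0 := Set.Ioi_subset_Ioi hr.le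
  refine Integrable.mono' ((hPint.mono_set hsub).const_mul (min 1 r)⁻¹)
    ((aux_meas hPint).mono_set hsub) ?_
  filter_upwards [ae_restrict_mem measurableSet_Ioi] with y hy
  have h0 : 0 < min 1 r := lt_min one_pos hr
  have hy' : r < y := hy
  have hp := hnn y (hr.trans hy')
  rw [Real.norm_of_nonneg hp, ← mul_assoc]
  have h1 : 1 ≤ (min 1 r)⁻¹ * min 1 y := by
    rw [inv_mul_eq_div, one_le_div h0]
    exact min_le_min le_rfl hy'.le
  nlinarith

lemma aux_kmeas (hPint : IntegrableOn (fun y : ℝ => min 1 y * Pib y) (Set.Ioi 0)) (z : ℂ) :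
    AEStronglyMeasurable (fun y : ℝ => (1 - Complex.exp (-(z * (y : ℂ)))) * (Pib y : ℂ))
      (volume.restrict (Set.Ioi 0)) := by
  refine AEStronglyMeasurable.mul ?_ (Complex.continuous_ofReal.comp_aestronglyMeasurable (aux_meas hPint))
  exact Continuous.aestronglyMeasurable (by fun_prop)

lemma aux_kint (hnn : ∀ y : ℝ, 0 < y → 0 ≤ Pib y)
    (hPint : IntegrableOn (fun y : ℝ => min 1 y * Pib y) (Set.Ioi 0)) (z : ℂ) (hz : 0 ≤ z.re) :
    IntegrableOn (fun y : ℝ => (1 - Complex.exp (-(z * (y : ℂ)))) * (Pib y : ℂ)) (Set.Ioi 0) := by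
  refine aux_int_of_bound hPint _ (2 * (1 + ‖z‖)) (aux_kmeas hPint z) ?_
  intro y hy
  have hp := hnn y hy
  rw [norm_mul, Complex.norm_real, Real.norm_of_nonneg hp, ← mul_assoc]
  gcongr
  refine (aux_norm (z * y) (by simpa using mul_nonneg hz hy.le)).trans ?_
  rw [mul_assoc]
  gcongr
  rw [norm_mul, Complex.norm_real, Real.norm_of_nonneg hy.le]
  have := norm_nonneg z
  rcases le_total 1 y with h | h
  · rw [min_eq_left h]; exact (min_le_left _ _).trans (by linarith)
  · rw [min_eq_right h]; exact (min_le_right _ _).trans (by nlinarith)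

/-- Key comparison estimates. -/
lemma aux_bound (hnn : ∀ y : ℝ, 0 < y → 0 ≤ Pib y)
    (hPint : IntegrableOn (fun y : ℝ => min 1 y * Pib y) (Set.Ioi 0)) {m : ℝ} (hm : 0 ≤ m)
    (φC : ℂ → ℂ)
    (hrepC : ∀ z : ℂ, 0 ≤ z.re →
      φC z = (m : ℂ)
        + ∫ y in Set.Ioi (0:ℝ), (1 - Complex.exp (-(z * (y : ℂ)))) * (Pib y : ℂ))
    (b u : ℝ) (hb : 0 < b) (hu : 0 < u) :
    0 ≤ (φC ((b * u : ℝ) : ℂ)).re ∧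
    (φC ((b * u : ℝ) : ℂ)).re ≤ (φC (((b * u : ℝ) : ℂ) + (b : ℂ) * Complex.I)).re ∧
    (φC (((b * u : ℝ) : ℂ) + (b : ℂ) * Complex.I)).re ≤ (1 + 1 / u^2) * (φC ((b * u : ℝ) : ℂ)).re ∧
    |(φC (((b * u : ℝ) : ℂ) + (b : ℂ) * Complex.I)).im| ≤ 1 / u * (φC ((b * u : ℝ) : ℂ)).re := by
  set x : ℂ := ((b * u : ℝ) : ℂ) with hx
  set w : ℂ := x + (b : ℂ) * Complex.I with hw
  have hbu : 0 < b * u := mul_pos hb hu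
  have hxr : 0 ≤ x.re := by simpa [hx] using hbu.le
  have hwr : 0 ≤ w.re := by simpa [hw, hx] using hbu.le
  have ix := aux_kint hnn hPint x hxr
  have iw := aux_kint hnn hPint w hwr
  set kx : ℝ → ℂ := fun y : ℝ => (1 - Complex.exp (-(x * (y : ℂ)))) * (Pib y : ℂ) with hkx
  set kw : ℝ → ℂ := fun y : ℝ => (1 - Complex.exp (-(w * (y : ℂ)))) * (Pib y : ℂ) with hkw
  have ex : ∀ y, (kx y).re = (1 - Real.exp (-(b*u*y))) * Pib y := by
    intro y
    simp [hkx, hx, Complex.exp_re]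
  have ewr : ∀ y, (kw y).re = (1 - Real.exp (-(b*u*y)) * Real.cos (b*y)) * Pib y := by
    intro y
    simp [hkw, hw, hx, Complex.exp_re]
  have ewi : ∀ y, (kw y).im = (Real.exp (-(b*u*y)) * Real.sin (b*y)) * Pib y := by
    intro y
    simp [hkw, hw, hx, Complex.exp_im]
  have rx : (φC x).re = m + ∫ y in Set.Ioi (0:ℝ), (kx y).re := by
    rw [hrepC x hxr, Complex.add_re, Complex.ofReal_re]
    congr 1
    exact (integral_re ix).symm
  have hwre : (φC w).re = m + ∫ y in Set.Ioi (0:ℝ), (kw y).re := by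
    rw [hrepC w hwr, Complex.add_re, Complex.ofReal_re]
    congr 1
    exact (integral_re iw).symm
  have iw' : (φC w).im = ∫ y in Set.Ioi (0:ℝ), (kw y).im := by
    rw [hrepC w hwr, Complex.add_im, Complex.ofReal_im, zero_add]
    exact (integral_im iw).symm
  have ixr : IntegrableOn (fun y => (kx y).re) (Set.Ioi 0) := ix.re
  have iwr : IntegrableOn (fun y => (kw y).re) (Set.Ioi 0) := iw.re
  have iwi : IntegrableOn (fun y => (kw y).im) (Set.Ioi 0) := iw.im
  have hu1 : 0 < 1 / u := by positivity
  have hu2 : 0 < 1 / u^2 := by positivity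
  refine ⟨?_, ?_, ?_, ?_⟩
  · rw [rx]
    refine add_nonneg hm (setIntegral_nonneg measurableSet_Ioi fun y hy => ?_)
    have hy' : 0 < y := hy
    rw [ex]
    refine mul_nonneg ?_ (hnn y hy')
    rw [sub_nonneg, Real.exp_le_one_iff]
    have : 0 < b * u * y := by positivity
    linarith
  · rw [rx, hwre]
    refine add_le_add le_rfl ?_
    refine setIntegral_mono_on ixr iwr measurableSet_Ioi fun y hy => ?_
    rw [ex, ewr]
    have := hnn y hy
    gcongr
    exact mul_le_of_le_one_right (Real.exp_nonneg _) (Real.cos_le_one _)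
  · rw [rx, hwre, mul_add]
    refine add_le_add (by nlinarith) ?_
    rw [← integral_const_mul]
    refine setIntegral_mono_on iwr (ixr.const_mul _) measurableSet_Ioi fun y hy => ?_
    have hy' : 0 < y := hy
    rw [ex, ewr, ← mul_assoc]
    have := hnn y hy
    gcongr
    set t := b * u * y with ht
    have ht0 : 0 < t := by positivity
    have hc := Real.one_sub_sq_div_two_le_cos (x := b * y)
    have hq := Real.quadratic_le_exp_of_nonneg ht0.le
    have he : Real.exp (-t) * Real.exp t = 1 := by rw [← Real.exp_add]; simp
    have hep := Real.exp_pos (-t)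
    have hby : (b*y)^2 = 1/u^2 * t^2 := by rw [ht]; field_simp
    have h1 : Real.exp (-t) * (1 + t^2/2) ≤ 1 := by
      rw [← he]; gcongr; linarith
    have h2 : Real.exp (-t) * (1 - 1/u^2*t^2/2) ≤ Real.exp (-t) * Real.cos (b*y) := by
      gcongr; rw [← hby]; exact hc
    nlinarith
  · rw [rx, iw', mul_add]
    refine le_trans ?_ (le_add_of_nonneg_left (by positivity))
    rw [← integral_const_mul]
    refine (abs_integral_le_integral_abs).trans ?_
    refine setIntegral_mono_on iwi.abs (ixr.const_mul _) measurableSet_Ioi fun y hy => ?_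
    have hy' : 0 < y := hy
    have hp := hnn y hy
    rw [ex, ewi, ← mul_assoc, abs_mul, abs_mul, abs_of_nonneg hp, Real.abs_exp]
    refine mul_le_mul_of_nonneg_right ?_ hp
    set t := b * u * y with ht
    have ht0 : 0 < t := by positivity
    have hs : |Real.sin (b*y)| ≤ b * y := by
      have := Real.abs_sin_le_abs (x := b * y)
      rwa [abs_of_pos (by positivity : 0 < b * y)] at this
    have hby : b*y = 1/u * t := by rw [ht]; field_simp
    have he : Real.exp (-t) * Real.exp t = 1 := by rw [← Real.exp_add]; simp
    have h1 : Real.exp (-t) * (1 + t) ≤ 1 := by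
      rw [← he]; gcongr; linarith [Real.add_one_le_exp t]
    calc Real.exp (-t) * |Real.sin (b*y)| ≤ Real.exp (-t) * (1/u * t) := by
          gcongr; rw [← hby]; exact hs
      _ = 1/u * (Real.exp (-t) * t) := by ring
      _ ≤ _ := by gcongr; linarith

lemma aux_log_bound (p : ℝ) (w : ℂ) (u : ℝ) (hu : 0 < u) (h0 : 0 ≤ p) (h1 : p ≤ w.re)
    (h2 : w.re ≤ (1 + 1 / u^2) * p) (h3 : |w.im| ≤ 1 / u * p) :
    |Real.log (‖w‖ / p)| ≤ 3 / 2 * Real.log (1 + 1 / u^2) := by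
  rcases h0.eq_or_lt with h | h
  · subst h; simp; have := aux_log_nonneg u; simpa using this
  have hw : p ≤ ‖w‖ := h1.trans (Complex.re_le_norm w)
  have hr : 1 ≤ ‖w‖ / p := by rwa [one_le_div h]
  rw [abs_of_nonneg (Real.log_nonneg hr)]
  have hsq : (‖w‖ / p)^2 ≤ (1 + 1 / u^2)^3 := by
    rw [div_pow, div_le_iff₀ (by positivity), Complex.sq_norm, Complex.normSq_apply]
    set v := 1 / u^2 with hv
    have hv0 : 0 < v := by positivity
    have a1 : w.re * w.re ≤ ((1+v)*p) * ((1+v)*p) := by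
      apply mul_self_le_mul_self (h.le.trans h1) h2
    have a2 : w.im * w.im ≤ v * p^2 := by
      have := mul_self_le_mul_self (abs_nonneg _) h3
      rw [abs_mul_abs_self] at this
      refine this.trans_eq ?_
      rw [hv]; field_simp
    have : v * p^2 ≤ v * (1+v)^2 * p^2 := by
      have : (1:ℝ) ≤ (1+v)^2 := by nlinarith
      have hp2 : 0 < v * p^2 := by positivity
      nlinarith
    nlinarith
  have := Real.log_le_log (by positivity) hsq
  rw [Real.log_pow, Real.log_pow] at this
  push_cast at this
  linarith

lemma aux_gamma_int (s c : ℝ) (hs : -1 < s) (hc : 0 < c) :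
    IntegrableOn (fun t : ℝ => t ^ s * Real.exp (-c * t)) (Set.Ioi 0) := by
  simpa using integrableOn_rpow_mul_exp_neg_mul_rpow hs one_pos hc

lemma aux_gamma_diff (α : ℝ) (hα : α ∈ Set.Ioo (0:ℝ) 1) (w : ℂ) (hw : 0 < w.re) :
    DifferentiableAt ℂ
      (fun z : ℂ => ∫ t in Set.Ioi (0:ℝ), ((t ^ (-α) : ℝ) : ℂ) * Complex.exp (-(z * t))) w := by
  have hmeas : ∀ (s : ℝ) (z : ℂ), AEStronglyMeasurable
      (fun t : ℝ => ((t ^ s : ℝ) : ℂ) * Complex.exp (-(z * t))) (volume.restrict (Set.Ioi 0)) := by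
    intro s z
    exact Measurable.aestronglyMeasurable (by fun_prop)
  have hnorm : ∀ (s : ℝ) (z : ℂ) (t : ℝ), 0 < t →
      ‖((t ^ s : ℝ) : ℂ) * Complex.exp (-(z * t))‖ = t ^ s * Real.exp (-z.re * t) := by
    intro s z t ht
    rw [norm_mul, Complex.norm_real, Real.norm_of_nonneg (by positivity), Complex.norm_exp]
    simp
  have := hasDerivAt_integral_of_dominated_loc_of_deriv_le
    (μ := volume.restrict (Set.Ioi (0:ℝ)))
    (F := fun (z : ℂ) (t : ℝ) => ((t ^ (-α) : ℝ) : ℂ) * Complex.exp (-(z * t)))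
    (F' := fun (z : ℂ) (t : ℝ) => ((t ^ (-α) : ℝ) : ℂ) * (Complex.exp (-(z * t)) * (-t)))
    (x₀ := w) (s := Metric.ball w (w.re / 2))
    (bound := fun t => t ^ (1 - α) * Real.exp (-(w.re / 2) * t))
    (Metric.ball_mem_nhds w (by positivity))
    (Filter.Eventually.of_forall fun z => hmeas _ z)
    ?_ ?_ ?_ ?_ ?_
  · exact this.2.differentiableAt
  · refine Integrable.mono' (aux_gamma_int (-α) w.re (by linarith [hα.2]) hw) (hmeas _ _) ?_
    filter_upwards [ae_restrict_mem measurableSet_Ioi] with t ht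
    exact (hnorm _ _ _ ht).le
  · exact Measurable.aestronglyMeasurable (by fun_prop)
  · filter_upwards [ae_restrict_mem measurableSet_Ioi] with t ht z hz
    have ht' : 0 < t := ht
    rw [← mul_assoc, norm_mul, hnorm _ _ _ ht']
    have h1 : ‖(-(t:ℂ))‖ = t := by simp [abs_of_pos ht']
    rw [h1, show (1 - α) = -α + 1 by ring, Real.rpow_add ht', Real.rpow_one]
    have hre : w.re / 2 ≤ z.re := by
      have h2 : |(z - w).re| ≤ ‖z - w‖ := Complex.abs_re_le_norm _
      have h3 : ‖z - w‖ < w.re / 2 := by simpa [dist_eq_norm] using hz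
      have h4 := abs_le.1 h2
      simp at h4
      linarith
    have : Real.exp (-z.re * t) ≤ Real.exp (-(w.re/2) * t) := by
      apply Real.exp_le_exp.2; nlinarith
    calc _ = t ^ (-α) * t * Real.exp (-z.re * t) := by ring
      _ ≤ _ := by gcongr
  · exact aux_gamma_int _ _ (by linarith [hα.2]) (by positivity)
  · refine Filter.Eventually.of_forall fun t z _ => ?_
    refine HasDerivAt.const_mul _ ?_
    have : HasDerivAt (fun z : ℂ => -(z * (t:ℂ))) (-(t:ℂ)) z := by
      have h := ((hasDerivAt_id z).mul_const (t:ℂ)).neg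
      rw [one_mul] at h
      exact h
    exact this.cexp

lemma aux_gamma_complex (α : ℝ) (hα : α ∈ Set.Ioo (0:ℝ) 1) (w : ℂ) (hw : 0 < w.re) :
    ∫ t in Set.Ioi (0:ℝ), ((t ^ (-α) : ℝ) : ℂ) * Complex.exp (-(w * t))
      = w ^ ((α : ℂ) - 1) * (Real.Gamma (1 - α) : ℂ) := by
  set U : Set ℂ := {z | 0 < z.re} with hU
  have hUo : IsOpen U := isOpen_lt continuous_const Complex.continuous_re
  have hUc : IsPreconnected U := (convex_halfSpace_re_gt 0).isPreconnected
  have hf : AnalyticOnNhd ℂ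
      (fun z : ℂ => ∫ t in Set.Ioi (0:ℝ), ((t ^ (-α) : ℝ) : ℂ) * Complex.exp (-(z * t))) U :=
    DifferentiableOn.analyticOnNhd
      (fun z hz => (aux_gamma_diff α hα z hz).differentiableWithinAt) hUo
  have hg : AnalyticOnNhd ℂ
      (fun z : ℂ => z ^ ((α : ℂ) - 1) * (Real.Gamma (1 - α) : ℂ)) U := by
    refine DifferentiableOn.analyticOnNhd (fun z hz => ?_) hUo
    refine DifferentiableAt.differentiableWithinAt ?_
    refine DifferentiableAt.mul_const ?_ _
    exact (differentiableAt_id).cpow_const (Or.inl hz)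
  refine hf.eqOn_of_preconnected_of_frequently_eq hg hUc (z₀ := 1) (by simp [hU]) ?_ hw
  have ht : Filter.Tendsto (fun r : ℝ => (r : ℂ)) (nhdsWithin 1 (Set.Ioi 1)) (nhdsWithin 1 {1}ᶜ) := by
    refine tendsto_nhdsWithin_iff.2 ⟨?_, ?_⟩
    · have := (Complex.continuous_ofReal.tendsto 1).mono_left
        (nhdsWithin_le_nhds (s := Set.Ioi (1:ℝ)))
      simpa using this
    · filter_upwards [self_mem_nhdsWithin] with r hr
      have : (1:ℝ) < r := hr
      simp only [Set.mem_compl_iff, Set.mem_singleton_iff]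
      exact_mod_cast this.ne'
  refine ht.frequently (Filter.Eventually.frequently ?_)
  filter_upwards [self_mem_nhdsWithin] with r hr
  have hr0 : (0:ℝ) < r := one_pos.trans hr
  have h1 := Complex.integral_cpow_mul_exp_neg_mul_Ioi (a := ((1 - α : ℝ) : ℂ)) (r := r)
    (by simpa using hα.2) hr0
  rw [Complex.Gamma_ofReal, one_div, Complex.inv_cpow _ _ (by
    rw [Complex.arg_ofReal_of_nonneg hr0.le]; exact Real.pi_pos.ne), ← Complex.cpow_neg] at h1
  have e1 : -((1 - α : ℝ) : ℂ) = (α : ℂ) - 1 := by push_cast; ring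
  rw [e1] at h1
  rw [← h1]
  refine setIntegral_congr_fun measurableSet_Ioi fun t ht => ?_
  have ht0 : (0:ℝ) < t := ht
  rw [Complex.ofReal_cpow ht0.le]
  congr 2
  push_cast; ring

lemma aux_laplace (hnn : ∀ y : ℝ, 0 < y → 0 ≤ Pib y)
    (hPint : IntegrableOn (fun y : ℝ => min 1 y * Pib y) (Set.Ioi 0)) (z : ℂ) (hz : 0 < z.re) :
    ∫ y in Set.Ioi (0:ℝ), (1 - Complex.exp (-(z * (y : ℂ)))) * (Pib y : ℂ)
      = z * ∫ r in Set.Ioi (0:ℝ), Complex.exp (-(z * r)) * ((∫ y in Set.Ioi r, Pib y : ℝ) : ℂ) := by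
  have hz0 : z ≠ 0 := by rintro rfl; simp at hz
  set F : ℝ → ℝ → ℂ := fun y r =>
    (Set.Iio y).indicator (fun r : ℝ => z * Complex.exp (-(z * r))) r * (Pib y : ℂ) with hF
  have hFmeas : AEStronglyMeasurable (Function.uncurry F)
      ((volume.restrict (Set.Ioi (0:ℝ))).prod (volume.restrict (Set.Ioi (0:ℝ)))) := by
    have h1 : Measurable (fun p : ℝ × ℝ =>
        ({p : ℝ × ℝ | p.2 < p.1}).indicator (fun p => z * Complex.exp (-(z * p.2))) p) := by
      refine Measurable.indicator (by fun_prop) (measurableSet_lt measurable_snd measurable_fst)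
    have h2 := (Complex.continuous_ofReal.comp_aestronglyMeasurable (aux_meas hPint)).comp_fst
      (ν := volume.restrict (Set.Ioi (0:ℝ)))
    exact h1.aestronglyMeasurable.mul h2
  have hin : ∀ (c : ℂ), c ≠ 0 → ∀ y : ℝ, 0 < y →
      ∫ r in Set.Ioi (0:ℝ), (Set.Iio y).indicator (fun r : ℝ => Complex.exp (-(c * r))) r
        = (1 - Complex.exp (-(c * y))) / c := by
    intro c hc y hy
    rw [setIntegral_indicator measurableSet_Iio, Set.Ioi_inter_Iio, ← integral_Ioc_eq_integral_Ioo,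
      ← intervalIntegral.integral_of_le hy.le]
    have := integral_exp_mul_complex (a := 0) (b := y) (neg_ne_zero.2 hc)
    simp only [neg_mul] at this
    rw [this]
    field_simp
    simp
  have hFin : ∀ y : ℝ, 0 < y → ∫ r in Set.Ioi (0:ℝ), F y r
      = (1 - Complex.exp (-(z * (y : ℂ)))) * (Pib y : ℂ) := by
    intro y hy
    simp only [hF]
    rw [integral_mul_const]
    congr 1
    have : ∀ r, (Set.Iio y).indicator (fun r : ℝ => z * Complex.exp (-(z * r))) r
      = z * (Set.Iio y).indicator (fun r : ℝ => Complex.exp (-(z * r))) r := by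
      intro r; by_cases h : r ∈ Set.Iio y <;> simp [h]
    simp only [this]
    rw [integral_const_mul, hin z hz0 y hy]
    field_simp
  have hFint : Integrable (Function.uncurry F)
      ((volume.restrict (Set.Ioi (0:ℝ))).prod (volume.restrict (Set.Ioi (0:ℝ)))) := by
    rw [integrable_prod_iff hFmeas]
    constructor
    · refine Filter.Eventually.of_forall fun y => ?_
      simp only [Function.uncurry, hF]
      refine Integrable.mul_const ?_ _
      refine Integrable.indicator ?_ measurableSet_Iio
      refine Integrable.const_mul ?_ _
      have := integrableOn_exp_mul_complex_Ioi (a := -z) (by simpa using hz) 0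
      simp only [neg_mul] at this
      exact this
    · have hk := (aux_kint hnn hPint (z.re : ℂ) (by simpa using hz.le)).norm.const_mul (‖z‖ / z.re)
      refine hk.congr ?_
      filter_upwards [ae_restrict_mem measurableSet_Ioi] with y hy
      have hy0 : (0:ℝ) < y := hy
      have hp := hnn y hy0
      have e1 : ∀ r, ‖Function.uncurry F (y, r)‖
          = ‖z‖ * ((Set.Iio y).indicator (fun r : ℝ => Real.exp (-(z.re * r))) r) * Pib y := by
        intro r
        simp only [Function.uncurry, hF]
        rw [norm_mul, Complex.norm_real, Real.norm_of_nonneg hp]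
        congr 1
        by_cases h : r ∈ Set.Iio y
        · simp only [Set.indicator_of_mem h]
          rw [norm_mul, Complex.norm_exp]; simp
        · simp [h]
      simp only [e1]
      rw [integral_mul_const, integral_const_mul]
      have e2 : ∫ r in Set.Ioi (0:ℝ), (Set.Iio y).indicator (fun r : ℝ => Real.exp (-(z.re * r))) r
          = (1 - Real.exp (-(z.re * y))) / z.re := by
        have h := hin (z.re : ℂ) (by exact_mod_cast hz.ne') y hy0
        have e3 : ∀ r, (Set.Iio y).indicator (fun r : ℝ => Complex.exp (-((z.re:ℂ) * r))) r
          = (((Set.Iio y).indicator (fun r : ℝ => Real.exp (-(z.re * r))) r : ℝ) : ℂ) := by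
          intro r; by_cases h : r ∈ Set.Iio y <;> simp [h]
        simp only [e3] at h
        rw [integral_complex_ofReal] at h
        exact_mod_cast h
      rw [e2, norm_mul, Complex.norm_real, Real.norm_of_nonneg hp]
      have e4 : ‖1 - Complex.exp (-((z.re:ℂ) * y))‖ = 1 - Real.exp (-(z.re * y)) := by
        have : 1 - Complex.exp (-((z.re:ℂ) * y)) = ((1 - Real.exp (-(z.re * y)) : ℝ) : ℂ) := by
          push_cast; rfl
        rw [this, Complex.norm_real, Real.norm_of_nonneg]
        rw [sub_nonneg, Real.exp_le_one_iff]
        have : 0 < z.re * y := by positivity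
        linarith
      rw [e4]
      ring
  rw [← setIntegral_congr_fun measurableSet_Ioi (fun y hy => hFin y hy),
    integral_integral_swap hFint, ← integral_const_mul]
  refine setIntegral_congr_fun measurableSet_Ioi fun r hr => ?_
  have hr0 : (0:ℝ) < r := hr
  have e1 : ∀ y, F y r = (Set.Ioi r).indicator
      (fun y : ℝ => z * Complex.exp (-(z * r)) * (Pib y : ℂ)) y := by
    intro y
    by_cases h : r < y <;> simp [hF, h]
  simp only [e1]
  rw [setIntegral_indicator measurableSet_Ioi, Set.Ioi_inter_Ioi, sup_eq_right.2 hr0.le,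
    integral_const_mul, integral_complex_ofReal, mul_assoc]

lemma aux_tail_anti (hnn : ∀ y : ℝ, 0 < y → 0 ≤ Pib y)
    (hPint : IntegrableOn (fun y : ℝ => min 1 y * Pib y) (Set.Ioi 0)) :
    AntitoneOn (fun r : ℝ => ∫ y in Set.Ioi r, Pib y) (Set.Ioi 0) := by
  intro r hr s hs hrs
  have hr0 : (0:ℝ) < r := hr
  refine setIntegral_mono_set (aux_int_Ioi hnn hPint r hr) ?_ (Set.Ioi_subset_Ioi hrs).eventuallyLE
  filter_upwards [ae_restrict_mem measurableSet_Ioi] with y hy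
  exact hnn y (hr0.trans hy)

lemma aux_tail_nonneg (hnn : ∀ y : ℝ, 0 < y → 0 ≤ Pib y) (r : ℝ) (hr : 0 < r) :
    0 ≤ ∫ y in Set.Ioi r, Pib y :=
  setIntegral_nonneg measurableSet_Ioi fun y hy => hnn y (hr.trans hy)

lemma aux_tail_bound (hnn : ∀ y : ℝ, 0 < y → 0 ≤ Pib y)
    (hPint : IntegrableOn (fun y : ℝ => min 1 y * Pib y) (Set.Ioi 0)) {Cb α : ℝ} (hCb : 0 < Cb)
    (hAs : Filter.Tendsto
      (fun y : ℝ => (∫ r in Set.Ioi y, Pib r) / (Cb * y ^ (-α)))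
      (nhdsWithin 0 (Set.Ioi 0)) (nhds 1)) :
    ∃ K : ℝ, 0 ≤ K ∧ ∀ y : ℝ, 0 < y → ∫ r in Set.Ioi y, Pib r ≤ 2 * Cb * y ^ (-α) + K := by
  have h := hAs.eventually (gt_mem_nhds (by norm_num : (1:ℝ) < 2))
  obtain ⟨δ, hδ, hd⟩ := mem_nhdsGT_iff_exists_Ioc_subset.1 h
  have hδ0 : (0:ℝ) < δ := hδ
  refine ⟨_, aux_tail_nonneg hnn δ hδ0, fun y hy => ?_⟩
  rcases le_total y δ with hyd | hyd
  · have h1 : (∫ r in Set.Ioi y, Pib r) / (Cb * y ^ (-α)) < 2 := hd ⟨hy, hyd⟩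
    rw [div_lt_iff₀ (by positivity)] at h1
    have := aux_tail_nonneg hnn δ hδ0
    linarith
  · have h1 := aux_tail_anti hnn hPint hδ hy hyd
    have : 0 < 2 * Cb * y ^ (-α) := by positivity
    simp only at h1
    linarith

lemma aux_main (hnn : ∀ y : ℝ, 0 < y → 0 ≤ Pib y)
    (hPint : IntegrableOn (fun y : ℝ => min 1 y * Pib y) (Set.Ioi 0)) {m Cb α : ℝ}
    (hα : α ∈ Set.Ioo (0:ℝ) 1) (hCb : 0 < Cb)
    (φC : ℂ → ℂ)
    (hrepC : ∀ z : ℂ, 0 ≤ z.re →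
      φC z = (m : ℂ)
        + ∫ y in Set.Ioi (0:ℝ), (1 - Complex.exp (-(z * (y : ℂ)))) * (Pib y : ℂ))
    (hAs : Filter.Tendsto
      (fun y : ℝ => (∫ r in Set.Ioi y, Pib r) / (Cb * y ^ (-α)))
      (nhdsWithin 0 (Set.Ioi 0)) (nhds 1)) (w : ℂ) (hw : 0 < w.re) :
    Filter.Tendsto (fun b : ℝ => ((b ^ (-α) : ℝ) : ℂ) * φC ((b : ℂ) * w))
      Filter.atTop (nhds (((Cb * Real.Gamma (1 - α) : ℝ) : ℂ) * w ^ (α : ℂ))) := by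
  have hw0 : w ≠ 0 := by rintro rfl; simp at hw
  obtain ⟨K, hK, hbd⟩ := aux_tail_bound hnn hPint hCb hAs
  set T : ℝ → ℝ := fun y => ∫ r in Set.Ioi y, Pib r with hT
  have hTm : AEStronglyMeasurable T (volume.restrict (Set.Ioi 0)) :=
    (aemeasurable_restrict_of_antitoneOn measurableSet_Ioi
      (aux_tail_anti hnn hPint)).aestronglyMeasurable
  have hTn : ∀ r, 0 < r → 0 ≤ T r := fun r hr => aux_tail_nonneg hnn r hr
  have hre : ∀ b : ℝ, 0 < b → ((b ^ (-α) : ℝ) : ℂ) * φC ((b : ℂ) * w)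
      = ((b ^ (-α) : ℝ) : ℂ) * m + w * ∫ s in Set.Ioi (0:ℝ),
        Complex.exp (-(w * s)) * ((b ^ (-α) * T (b⁻¹ * s) : ℝ) : ℂ) := by
    intro b hb
    have hbw : 0 < ((b:ℂ) * w).re := by simpa using mul_pos hb hw
    rw [hrepC _ hbw.le, aux_laplace hnn hPint _ hbw, mul_add]
    congr 1
    have hs := integral_comp_mul_left_Ioi
      (fun r : ℝ => Complex.exp (-((b:ℂ) * w * r)) * (T r : ℂ)) 0 (inv_pos.2 hb)
    rw [mul_zero, inv_inv] at hs
    have e : ∀ s : ℝ, Complex.exp (-(w * s)) * ((b ^ (-α) * T (b⁻¹ * s) : ℝ) : ℂ)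
        = ((b ^ (-α) : ℝ) : ℂ) * (Complex.exp (-((b:ℂ) * w * ((b⁻¹ * s : ℝ) : ℂ))) * (T (b⁻¹ * s) : ℂ)) := by
      intro s
      have : (b:ℂ) * w * ((b⁻¹ * s : ℝ) : ℂ) = w * s := by
        have : (b:ℂ) ≠ 0 := by exact_mod_cast hb.ne'
        push_cast; field_simp
      rw [this]; push_cast; ring
    simp only [e]
    rw [integral_const_mul, hs, Complex.real_smul]
    ring
  have hlim0 : Filter.Tendsto (fun b : ℝ => ((b ^ (-α) : ℝ) : ℂ) * m) Filter.atTop (nhds 0) := by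
    have h1 : Filter.Tendsto (fun b : ℝ => ((b ^ (-α) : ℝ) : ℂ)) Filter.atTop (nhds ((0:ℝ):ℂ)) :=
      (Complex.continuous_ofReal.tendsto 0).comp (tendsto_rpow_neg_atTop hα.1)
    simpa using h1.mul_const (m:ℂ)
  have hlim : Filter.Tendsto (fun b : ℝ => ∫ s in Set.Ioi (0:ℝ),
        Complex.exp (-(w * s)) * ((b ^ (-α) * T (b⁻¹ * s) : ℝ) : ℂ)) Filter.atTop
      (nhds (∫ s in Set.Ioi (0:ℝ), Complex.exp (-(w * s)) * ((Cb * s ^ (-α) : ℝ) : ℂ))) := by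
    refine tendsto_integral_filter_of_dominated_convergence
      (fun s => 2 * Cb * (s ^ (-α) * Real.exp (-w.re * s)) + K * Real.exp (-w.re * s)) ?_ ?_ ?_ ?_
    · filter_upwards [Filter.eventually_gt_atTop 0] with b hb
      refine AEStronglyMeasurable.mul (Continuous.aestronglyMeasurable (by fun_prop)) ?_
      refine Complex.continuous_ofReal.comp_aestronglyMeasurable ?_
      refine AEStronglyMeasurable.const_mul ?_ _
      refine AEMeasurable.aestronglyMeasurable ?_
      refine aemeasurable_restrict_of_antitoneOn measurableSet_Ioi ?_
      intro r hr s hs hrs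
      have hr0 : (0:ℝ) < r := hr
      have hs0 : (0:ℝ) < s := hs
      exact aux_tail_anti hnn hPint (Set.mem_Ioi.2 (by positivity : 0 < b⁻¹ * r))
        (Set.mem_Ioi.2 (by positivity : 0 < b⁻¹ * s)) (by gcongr)
    · filter_upwards [Filter.eventually_ge_atTop 1] with b hb
      filter_upwards [ae_restrict_mem measurableSet_Ioi] with s hs
      have hs0 : (0:ℝ) < s := hs
      have hb0 : 0 < b := by linarith
      have h1 := hTn (b⁻¹ * s) (by positivity)
      have h2 := hbd (b⁻¹ * s) (by positivity)
      rw [norm_mul, Complex.norm_real, Real.norm_of_nonneg (by positivity), Complex.norm_exp]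
      have h3 : (b⁻¹ * s) ^ (-α) = b ^ α * s ^ (-α) := by
        rw [Real.mul_rpow (by positivity) hs0.le, Real.inv_rpow hb0.le, Real.rpow_neg hb0.le, inv_inv]
      have h4 : b ^ (-α) * b ^ α = 1 := by rw [← Real.rpow_add hb0]; simp
      have h5 : b ^ (-α) ≤ 1 := Real.rpow_le_one_of_one_le_of_nonpos hb (by linarith [hα.1])
      have h6 : b ^ (-α) * T (b⁻¹ * s) ≤ 2 * Cb * s ^ (-α) + K := by
        calc b ^ (-α) * T (b⁻¹ * s) ≤ b ^ (-α) * (2 * Cb * (b ^ α * s ^ (-α)) + K) := by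
              rw [← h3]; gcongr
          _ = (b ^ (-α) * b ^ α) * (2 * Cb * s ^ (-α)) + b ^ (-α) * K := by ring
          _ ≤ _ := by rw [h4]; nlinarith
      have h7 : (-(w * (s:ℂ))).re = -w.re * s := by simp
      rw [h7]
      have := Real.exp_pos (-w.re * s)
      nlinarith
    · refine Integrable.add ((aux_gamma_int _ _ (by linarith [hα.2]) hw).const_mul _) ?_
      have := aux_gamma_int 0 w.re (by norm_num) hw
      simp only [Real.rpow_zero, one_mul] at this
      exact this.const_mul K
    · filter_upwards [ae_restrict_mem measurableSet_Ioi] with s hs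
      have hs0 : (0:ℝ) < s := hs
      refine Filter.Tendsto.const_mul _ ((Complex.continuous_ofReal.tendsto _).comp ?_)
      have ht : Filter.Tendsto (fun b : ℝ => b⁻¹ * s) Filter.atTop (nhdsWithin 0 (Set.Ioi 0)) := by
        refine tendsto_nhdsWithin_iff.2 ⟨?_, ?_⟩
        · simpa using tendsto_inv_atTop_zero.mul_const s
        · filter_upwards [Filter.eventually_gt_atTop 0] with b hb
          exact Set.mem_Ioi.2 (by positivity)
      have h1 := (hAs.comp ht).const_mul (Cb * s ^ (-α))
      rw [mul_one] at h1
      refine h1.congr' ?_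
      filter_upwards [Filter.eventually_gt_atTop 0] with b hb
      simp only [Function.comp]
      have h3 : (b⁻¹ * s) ^ (-α) = b ^ α * s ^ (-α) := by
        rw [Real.mul_rpow (by positivity) hs0.le, Real.inv_rpow hb.le, Real.rpow_neg hb.le, inv_inv]
      rw [h3, Real.rpow_neg hb.le]
      have : 0 < s ^ (-α) := by positivity
      have : 0 < b ^ α := by positivity
      change _ * (T (b⁻¹ * s) / _) = _
      field_simp
  have hval : w * ∫ s in Set.Ioi (0:ℝ), Complex.exp (-(w * s)) * ((Cb * s ^ (-α) : ℝ) : ℂ)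
      = ((Cb * Real.Gamma (1 - α) : ℝ) : ℂ) * w ^ (α : ℂ) := by
    have e : ∀ s : ℝ, Complex.exp (-(w * s)) * ((Cb * s ^ (-α) : ℝ) : ℂ)
      = (Cb : ℂ) * (((s ^ (-α) : ℝ) : ℂ) * Complex.exp (-(w * s))) := by
      intro s; push_cast; ring
    simp only [e]
    rw [integral_const_mul, aux_gamma_complex α hα w hw, Complex.cpow_sub _ _ hw0, Complex.cpow_one]
    push_cast
    field_simp
  have := hlim0.add (hlim.const_mul w)
  rw [hval, zero_add] at this
  refine this.congr' ?_
  filter_upwards [Filter.eventually_gt_atTop 0] with b hb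
  exact (hre b hb).symm

lemma aux_phi_meas (hPint : IntegrableOn (fun y : ℝ => min 1 y * Pib y) (Set.Ioi 0)) {m : ℝ}
    (φC : ℂ → ℂ)
    (hrepC : ∀ z : ℂ, 0 ≤ z.re →
      φC z = (m : ℂ)
        + ∫ y in Set.Ioi (0:ℝ), (1 - Complex.exp (-(z * (y : ℂ)))) * (Pib y : ℂ))
    (g : ℝ → ℂ) (hg : Continuous g) (hg0 : ∀ u, 0 < u → 0 ≤ (g u).re) :
    AEStronglyMeasurable (fun u => φC (g u)) (volume.restrict (Set.Ioi 0)) := by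
  have h1 : AEStronglyMeasurable (fun p : ℝ × ℝ =>
      (1 - Complex.exp (-(g p.1 * (p.2 : ℂ)))) * (Pib p.2 : ℂ))
      ((volume.restrict (Set.Ioi (0:ℝ))).prod (volume.restrict (Set.Ioi (0:ℝ)))) := by
    refine AEStronglyMeasurable.mul (Continuous.aestronglyMeasurable (by fun_prop)) ?_
    exact (Complex.continuous_ofReal.comp_aestronglyMeasurable (aux_meas hPint)).comp_snd
  refine (h1.integral_prod_right'.const_add (m:ℂ)).congr ?_
  filter_upwards [ae_restrict_mem measurableSet_Ioi] with u hu
  exact (hrepC _ (hg0 u hu)).symm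
end

/-- for a `B_N` Bernstein function with `σ² = 0` whose double tail is
regularly varying at `0`, `Π̄̄(y) ∼ C̄ y^{-α}`, the extension satisfies
`b^{-α} φ(ab + ib) → C̄ Γ(1-α) (a+i)^α`, `b^{-α} φ(ab) → C̄ Γ(1-α) a^α`, and
`Θ_φ(0,b) → (π/2)α`. -/
theorem bernstein_regularly_varying_Theta_limit
    (φC : ℂ → ℂ) (Pib : ℝ → ℝ) (m Cb α : ℝ)
    (hm : 0 ≤ m) (hα : α ∈ Set.Ioo (0:ℝ) 1) (hCb : 0 < Cb)
    (hPib_nonneg : ∀ y : ℝ, 0 < y → 0 ≤ Pib y)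
    (hPib_anti : ∀ x y : ℝ, 0 < x → x ≤ y → Pib y ≤ Pib x)
    (hPib_int : IntegrableOn (fun y : ℝ => min 1 y * Pib y) (Set.Ioi 0))
    (hrepC : ∀ z : ℂ, 0 ≤ z.re →
      φC z = (m : ℂ)
        + ∫ y in Set.Ioi (0:ℝ), (1 - Complex.exp (-(z * (y : ℂ)))) * (Pib y : ℂ))
    (hAs : Filter.Tendsto
      (fun y : ℝ => (∫ r in Set.Ioi y, Pib r) / (Cb * y ^ (-α)))
      (nhdsWithin 0 (Set.Ioi 0)) (nhds 1)) :
    (∀ a : ℝ, 0 < a →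
      Filter.Tendsto
          (fun b : ℝ => ((b ^ (-α) : ℝ) : ℂ) * φC (((a * b : ℝ) : ℂ) + (b : ℂ) * Complex.I))
          Filter.atTop
          (nhds (((Cb * Real.Gamma (1 - α) : ℝ) : ℂ) * ((a : ℂ) + Complex.I) ^ (α : ℂ)))
      ∧ Filter.Tendsto (fun b : ℝ => b ^ (-α) * (φC ((a * b : ℝ) : ℂ)).re)
          Filter.atTop (nhds (Cb * Real.Gamma (1 - α) * a ^ α)))
    ∧ Filter.Tendsto (fun b : ℝ => Theta φC 0 b) Filter.atTop
        (nhds (Real.pi / 2 * α)) := by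
  have hmain := fun w hw =>
    aux_main hPib_nonneg hPib_int hα hCb φC hrepC hAs w hw
  have hpart : ∀ a : ℝ, 0 < a →
      Filter.Tendsto
          (fun b : ℝ => ((b ^ (-α) : ℝ) : ℂ) * φC (((a * b : ℝ) : ℂ) + (b : ℂ) * Complex.I))
          Filter.atTop
          (nhds (((Cb * Real.Gamma (1 - α) : ℝ) : ℂ) * ((a : ℂ) + Complex.I) ^ (α : ℂ)))
      ∧ Filter.Tendsto (fun b : ℝ => b ^ (-α) * (φC ((a * b : ℝ) : ℂ)).re)
          Filter.atTop (nhds (Cb * Real.Gamma (1 - α) * a ^ α)) := by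
    intro a ha
    constructor
    · refine (hmain ((a:ℂ) + Complex.I) (by simpa using ha)).congr fun b => ?_
      congr 2
      push_cast; ring
    · have h := (Complex.continuous_re.tendsto _).comp (hmain (a:ℂ) (by simpa using ha))
      have e : (((Cb * Real.Gamma (1 - α) : ℝ) : ℂ) * (a:ℂ) ^ (α : ℂ)).re
          = Cb * Real.Gamma (1 - α) * a ^ α := by
        rw [← Complex.ofReal_cpow ha.le, ← Complex.ofReal_mul, Complex.ofReal_re]
      rw [e] at h
      refine h.congr fun b => ?_
      simp only [Function.comp]
      rw [Complex.re_ofReal_mul]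
      congr 4
      push_cast; ring
  refine ⟨hpart, ?_⟩
  have hval : Real.pi / 2 * α = ∫ u in Set.Ioi (0:ℝ), α / 2 * Real.log (1 + 1 / u^2) := by
    rw [integral_const_mul, aux_integral]; ring
  rw [hval]
  simp only [Theta, zero_div]
  refine tendsto_integral_filter_of_dominated_convergence
    (fun u => 3 / 2 * Real.log (1 + 1 / u^2)) ?_ ?_ (aux_integrable.const_mul _) ?_
  · filter_upwards [Filter.eventually_gt_atTop 0] with b hb
    have h1 := aux_phi_meas hPib_int φC hrepC
      (fun u : ℝ => ((b * u : ℝ) : ℂ) + (b : ℂ) * Complex.I) (by fun_prop)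
      (fun u hu => by simpa using (mul_pos hb hu).le)
    have h2 := aux_phi_meas hPib_int φC hrepC
      (fun u : ℝ => ((b * u : ℝ) : ℂ)) (by fun_prop)
      (fun u hu => by simpa using (mul_pos hb hu).le)
    have h3 := Complex.continuous_re.comp_aestronglyMeasurable h2
    exact (Real.measurable_log.comp_aemeasurable
      (h1.norm.aemeasurable.div h3.aemeasurable)).aestronglyMeasurable
  · filter_upwards [Filter.eventually_gt_atTop 0] with b hb
    filter_upwards [ae_restrict_mem measurableSet_Ioi] with u hu
    obtain ⟨h0, h1, h2, h3⟩ := aux_bound hPib_nonneg hPib_int hm φC hrepC b u hb hu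
    exact aux_log_bound _ _ u hu h0 h1 h2 h3
  · filter_upwards [ae_restrict_mem measurableSet_Ioi] with u hu
    have hu0 : (0:ℝ) < u := hu
    obtain ⟨h1, h2⟩ := hpart u hu0
    have hG : 0 < Cb * Real.Gamma (1 - α) :=
      mul_pos hCb (Real.Gamma_pos_of_pos (by linarith [hα.2]))
    have hua : 0 < u ^ α := by positivity
    have hne : (u:ℂ) + Complex.I ≠ 0 := by
      intro h
      have := congrArg Complex.im h
      simp at this
    have hnp : 0 < ‖(u:ℂ) + Complex.I‖ := norm_pos_iff.2 hne
    have h3 := h1.norm.div h2 (by positivity)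
    have e1 : ‖((Cb * Real.Gamma (1 - α) : ℝ) : ℂ) * ((u : ℂ) + Complex.I) ^ (α : ℂ)‖
        = Cb * Real.Gamma (1 - α) * ‖(u:ℂ) + Complex.I‖ ^ α := by
      rw [norm_mul, Complex.norm_real, Real.norm_of_nonneg hG.le, Complex.norm_cpow_real]
    rw [e1] at h3
    have e2 : Cb * Real.Gamma (1 - α) * ‖(u:ℂ) + Complex.I‖ ^ α / (Cb * Real.Gamma (1 - α) * u ^ α)
        = (‖(u:ℂ) + Complex.I‖ / u) ^ α := by
      rw [mul_div_mul_left _ _ hG.ne', Real.div_rpow hnp.le hu0.le]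
    rw [e2] at h3
    have h4 := h3.log (by positivity)
    have e3 : Real.log ((‖(u:ℂ) + Complex.I‖ / u) ^ α) = α / 2 * Real.log (1 + 1 / u^2) := by
      rw [Real.log_rpow (by positivity)]
      have : (1 + 1 / u^2) = (‖(u:ℂ) + Complex.I‖ / u) ^ 2 := by
        rw [div_pow, Complex.sq_norm, Complex.normSq_apply]
        simp
        field_simp
      rw [this, Real.log_pow]; push_cast; ring
    rw [e3] at h4
    refine h4.congr' ?_
    filter_upwards [Filter.eventually_gt_atTop 0] with b hb
    have hb' : 0 < b ^ (-α) := by positivity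
    simp only [Pi.div_apply]
    rw [norm_mul, Complex.norm_real, Real.norm_of_nonneg hb'.le, mul_div_mul_left _ _ hb'.ne',
      mul_comm u b]
end
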